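/- arXiv:1904.04795 — 2 statements merged into one kernel-verified Lean document; each statement's English description precedes it below -/
import Mathlib

section
/- Weighted Hardy inequality with k derivatives: for every integer k ≥ 1, every real γ with 1 ≤ γ ≤ 3/2, and every f ∈ C_c^∞((0,∞)), one has ∫₀^∞ x^{2k−γ} (d^k/dx^k (f(x)/x))² dx ≤ ∫₀^∞ x^{2k−γ} (d^{k+1}f/dx^{k+1}(x))² dx. -/
open Real MeasureTheory Set

noncomputable section

theorem contDiff_div_id_of_tsupport {f : ℝ → ℝ} (hf : ContDiff ℝ (⊤ : ℕ∞) f)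
    (h0 : (0 : ℝ) ∉ tsupport f) : ContDiff ℝ (⊤ : ℕ∞) (fun y => f y / y) := by
  rw [contDiff_iff_contDiffAt]
  intro x
  rcases eq_or_ne x 0 with rfl | hx
  · refine (contDiffAt_const (c := (0 : ℝ))).congr_of_eventuallyEq ?_
    filter_upwards [notMem_tsupport_iff_eventuallyEq.mp h0] with y hy
    simp [hy]
  · exact hf.contDiffAt.div contDiffAt_id hx

theorem iteratedDeriv_succ_id_mul {g : ℝ → ℝ} (hg : ContDiff ℝ (⊤ : ℕ∞) g) (n : ℕ) :
    iteratedDeriv (n + 1) (fun y => y * g y) =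
      fun x => x * iteratedDeriv (n + 1) g x + (n + 1) * iteratedDeriv n g x := by
  have hd (m : ℕ) (x : ℝ) :
      HasDerivAt (iteratedDeriv m g) (iteratedDeriv (m + 1) g x) x := by
    rw [iteratedDeriv_succ]
    exact ((hg.differentiable_iteratedDeriv m (by exact_mod_cast WithTop.coe_lt_top _)) x).hasDerivAt
  induction n with
  | zero =>
    ext x
    have h := (hasDerivAt_id x).mul (hd 0 x)
    simp only [iteratedDeriv_zero] at h
    rw [zero_add, iteratedDeriv_one]
    refine h.deriv.trans ?_
    simp
    ring
  | succ n ih =>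
    ext x
    rw [iteratedDeriv_succ, ih]
    refine (((hasDerivAt_id x).mul (hd (n + 1) x)).add
      ((hd n x).const_mul ((n : ℝ) + 1))).deriv.trans ?_
    simp
    ring

theorem HasCompactSupport.iteratedDeriv {g : ℝ → ℝ} (hg : HasCompactSupport g) (n : ℕ) :
    HasCompactSupport (iteratedDeriv n g) := by
  induction n with
  | zero => simpa using hg
  | succ n ih => rw [iteratedDeriv_succ]; exact ih.deriv

theorem deriv_rpow_mul_sq {h : ℝ → ℝ} {x a : ℝ} (hh : DifferentiableAt ℝ h x) (hx : x ≠ 0) :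
    deriv (fun x : ℝ => x ^ (a + 1) * h x ^ 2) x =
      x ^ a * ((a + 1) * h x ^ 2 + 2 * x * h x * deriv h x) := by
  have h1 : HasDerivAt (fun x : ℝ => x ^ (a + 1)) ((a + 1) * x ^ a) x := by
    simpa using Real.hasDerivAt_rpow_const (p := a + 1) (Or.inl hx)
  have h2 : HasDerivAt (fun x => h x ^ 2) (2 * h x * deriv h x) x := by
    simpa using hh.hasDerivAt.fun_pow 2
  rw [(h1.fun_mul h2).deriv, Real.rpow_add_one hx]
  ring

/-- A weighted Hardy inequality, obtained by completing the square and integrating away the total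
derivative of `x ^ (a + 1) * h x ^ 2`. -/
theorem integral_rpow_mul_sq_le {h : ℝ → ℝ} (hh : ContDiff ℝ 1 h) (hs : HasCompactSupport h)
    {a c : ℝ} (ha : 0 ≤ a) (hc : 1 ≤ c - (a + 1) / 2) :
    ∫ x in Ioi (0 : ℝ), x ^ a * h x ^ 2 ≤
      ∫ x in Ioi (0 : ℝ), x ^ a * (x * deriv h x + c * h x) ^ 2 := by
  have hpow : Continuous fun x : ℝ => x ^ a := Real.continuous_rpow_const ha
  have hpow' : ContDiff ℝ 1 fun x : ℝ => x ^ (a + 1) := by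
    have := Real.contDiff_rpow_const_of_le (p := a + 1) (n := 1) (by simpa using ha)
    exact_mod_cast this
  have hd : Continuous (deriv h) := hh.continuous_deriv le_rfl
  have hF : ContDiff ℝ 1 fun x : ℝ => x ^ (a + 1) * h x ^ 2 := hpow'.mul (hh.pow 2)
  have hsq : HasCompactSupport fun x => h x ^ 2 := by
    simp only [sq]
    exact hs.mul_right
  have hFs : HasCompactSupport fun x : ℝ => x ^ (a + 1) * h x ^ 2 := hsq.mul_left
  have hint : ∫ x in Ioi (0 : ℝ), deriv (fun x : ℝ => x ^ (a + 1) * h x ^ 2) x = 0 := by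
    rw [hFs.integral_Ioi_deriv_eq hF, Real.zero_rpow (by positivity)]
    simp
  have hI1 : Integrable fun x : ℝ => x ^ a * h x ^ 2 :=
    (hpow.mul (hh.continuous.pow 2)).integrable_of_hasCompactSupport hsq.mul_left
  have hI2 : Integrable fun x : ℝ => x ^ a * (x * deriv h x + c * h x) ^ 2 := by
    have hc' : Continuous fun x => x * deriv h x + c * h x :=
      (continuous_id.mul hd).add (continuous_const.mul hh.continuous)
    have hs' : HasCompactSupport fun x => x * deriv h x + c * h x :=
      hs.deriv.mul_left.add hs.mul_left
    refine (hpow.mul (hc'.pow 2)).integrable_of_hasCompactSupport (HasCompactSupport.mul_left ?_)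
    simp only [sq]
    exact hs'.mul_right
  have hI3 : Integrable (deriv fun x : ℝ => x ^ (a + 1) * h x ^ 2) :=
    (hF.continuous_deriv le_rfl).integrable_of_hasCompactSupport hFs.deriv
  obtain ⟨b, hb⟩ : ∃ b, b = c - (a + 1) / 2 := ⟨_, rfl⟩
  rw [← hb] at hc
  calc ∫ x in Ioi (0 : ℝ), x ^ a * h x ^ 2
      = ∫ x in Ioi (0 : ℝ),
          (x ^ a * h x ^ 2 + b * deriv (fun x : ℝ => x ^ (a + 1) * h x ^ 2) x) := by
        rw [integral_add hI1.integrableOn (hI3.const_mul b).integrableOn, integral_const_mul, hint]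
        simp
    _ ≤ _ := by
        refine setIntegral_mono_on (hI1.add (hI3.const_mul b)).integrableOn hI2.integrableOn
          measurableSet_Ioi fun x (hx : 0 < x) => ?_
        rw [deriv_rpow_mul_sq (hh.differentiable one_ne_zero x) hx.ne']
        have hxa : 0 ≤ x ^ a := Real.rpow_nonneg hx.le a
        have hsq : h x ^ 2 + b * ((a + 1) * h x ^ 2 + 2 * x * h x * deriv h x) ≤
            (x * deriv h x + c * h x) ^ 2 := by
          have hcb : c = b + (a + 1) / 2 := by rw [hb]; ring
          rw [hcb]
          have hb1 : 0 ≤ (b ^ 2 - 1) * h x ^ 2 :=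
            mul_nonneg (by nlinarith) (sq_nonneg _)
          linarith [sq_nonneg (x * deriv h x + (a + 1) / 2 * h x)]
        linarith [mul_le_mul_of_nonneg_left hsq hxa]

/-- Weighted Hardy inequality with `k` derivatives: for every integer `k ≥ 1`, every
`γ ∈ [1, 3/2]`, and every `f ∈ C_c^∞((0,∞))`,
`∫_0^∞ x^{2k−γ} ((d/dx)^k (f(x)/x))² dx ≤ ∫_0^∞ x^{2k−γ} (f^{(k+1)}(x))² dx`. -/
theorem weighted_hardy_iterated (k : ℕ) (hk : 1 ≤ k) (γ : ℝ)
    (hγ : γ ∈ Icc (1 : ℝ) (3 / 2)) (f : ℝ → ℝ)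
    (hf : ContDiff ℝ (⊤ : ℕ∞) f) (hsupp : HasCompactSupport f)
    (hsupp' : tsupport f ⊆ Ioi 0) :
    ∫ x in Ioi (0 : ℝ),
        x ^ (2 * (k : ℝ) - γ) * (iteratedDeriv k (fun y => f y / y) x) ^ 2 ≤
      ∫ x in Ioi (0 : ℝ),
        x ^ (2 * (k : ℝ) - γ) * (iteratedDeriv (k + 1) f x) ^ 2 := by
  obtain ⟨hγ1, hγ2⟩ := hγ
  have hk' : (1 : ℝ) ≤ k := by exact_mod_cast hk
  have h0 : (0 : ℝ) ∉ tsupport f := fun h => lt_irrefl (0 : ℝ) (hsupp' h)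
  have hg := contDiff_div_id_of_tsupport hf h0
  have hgs : HasCompactSupport fun y => f y / y := by
    simp only [div_eq_mul_inv]
    exact hsupp.mul_right
  have hfg : f = fun y => y * (f y / y) := by
    ext y
    rcases eq_or_ne y 0 with rfl | hy
    · simpa using image_eq_zero_of_notMem_tsupport h0
    · field_simp
  have hd : iteratedDeriv (k + 1) f = fun x =>
      x * deriv (iteratedDeriv k fun y => f y / y) x +
        (k + 1) * iteratedDeriv k (fun y => f y / y) x := by
    conv_lhs => rw [hfg]
    rw [iteratedDeriv_succ_id_mul hg, iteratedDeriv_succ]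
  rw [hd]
  refine integral_rpow_mul_sq_le ?_ (hgs.iteratedDeriv k) (by linarith) (by linarith)
  rw [iteratedDeriv_eq_iterate]
  exact (hg.iterate_deriv k).of_le (by exact_mod_cast le_top)
end
end

section
/- Finite-time blow-up for the ODE inequality arising in the hyperbolic-flow example: for every constant c > 0, there is no continuously differentiable function μ : [0,∞) → ℝ satisfying μ(0) = 1 and μ'(t) ≥ c·μ(t)·∫₀^t μ(s) ds for all t ≥ 0. Equivalently, any C¹ solution of μ'(t) ≥ c·μ(t)·∫₀^t μ(s) ds with μ(0) = 1 defined on a maximal interval [0,T) has T < ∞ and becomes infinite as t → T. -/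
open Real MeasureTheory Set

noncomputable section

/-- A function continuous on `[a, ∞)` with nonnegative derivative on `(a, ∞)` is monotone there. -/
lemma monotoneOn_Ici_of_hasDerivAt_nonneg {f f' : ℝ → ℝ} {a : ℝ} (hf : ContinuousOn f (Ici a))
    (hd : ∀ t, a < t → HasDerivAt f (f' t) t) (hnn : ∀ t, a < t → 0 ≤ f' t) :
    MonotoneOn f (Ici a) := by
  refine monotoneOn_of_hasDerivWithinAt_nonneg (convex_Ici a) hf (f' := f') ?_ ?_
  · intro t ht
    rw [interior_Ici] at ht
    exact (hd t ht).hasDerivWithinAt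
  · intro t ht
    rw [interior_Ici] at ht
    exact hnn t ht

/-- The Riccati-type inequality `M' ≥ 1 + k M²` with `M 0 = 0` has no solution on `[0, ∞)`. -/
lemma not_forall_one_add_mul_sq_le_deriv {M m : ℝ → ℝ} {k : ℝ} (hk : 0 < k) (hM0 : M 0 = 0)
    (hM : ∀ t, HasDerivAt M (m t) t) : ¬ ∀ t, 0 ≤ t → 1 + k * M t ^ 2 ≤ m t := by
  intro h
  have hMc : Continuous M := continuous_iff_continuousAt.2 fun t => (hM t).continuousAt
  have hge : ∀ t, 0 ≤ t → t ≤ M t := by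
    intro t ht
    have hmono : MonotoneOn (fun t => M t - t) (Ici 0) :=
      monotoneOn_Ici_of_hasDerivAt_nonneg (by fun_prop)
        (fun t _ => (hM t).sub (hasDerivAt_id t))
        (fun t ht => by nlinarith [h t ht.le, mul_nonneg hk.le (sq_nonneg (M t))])
    have := hmono (mem_Ici.2 le_rfl) (mem_Ici.2 ht) ht
    simp only [hM0] at this
    linarith
  have hpos : ∀ t, 1 ≤ t → 0 < M t := fun t ht => by linarith [hge t (by linarith)]
  have hmono : MonotoneOn (fun t => -(M t)⁻¹ - k * t) (Ici 1) := by
    refine monotoneOn_Ici_of_hasDerivAt_nonneg (f' := fun t => -(-m t / M t ^ 2) - k * 1) ?_ ?_ ?_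
    · exact (hMc.continuousOn.inv₀ fun t ht => (hpos t ht).ne').neg.sub (by fun_prop)
    · intro t ht
      exact ((hM t).inv (hpos t ht.le).ne').neg.sub ((hasDerivAt_id t).const_mul k)
    · intro t ht
      have hsq : 0 < M t ^ 2 := pow_pos (hpos t ht.le) 2
      have hle : k ≤ m t / M t ^ 2 := by
        rw [le_div_iff₀ hsq]
        linarith [h t (by linarith)]
      rw [neg_div, neg_neg]
      linarith
  have hle : (1 : ℝ) ≤ 1 + 1 / k := by linarith [one_div_pos.2 hk]
  have hcmp := hmono (mem_Ici.2 le_rfl) (mem_Ici.2 hle) hle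
  have hinv : (M 1)⁻¹ ≤ 1 := inv_le_one_of_one_le₀ (hge 1 zero_le_one)
  have hinv' : 0 < (M (1 + 1 / k))⁻¹ := inv_pos.2 (hpos _ hle)
  have hk1 : k * (1 + 1 / k) = k + 1 := by field_simp
  simp only [hk1] at hcmp
  linarith

/-- Finite-time blow-up for the ODE inequality arising in the hyperbolic-flow example:
for every constant `c > 0`, there is no continuously differentiable function
`μ : [0,∞) → ℝ` with `μ(0) = 1` satisfying `μ'(t) ≥ c·μ(t)·∫_0^t μ(s) ds` for all
`t ≥ 0`. -/
theorem ode_inequality_blowup (c : ℝ) (hc : 0 < c) :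
    ¬ ∃ (μ μ' : ℝ → ℝ),
        ContinuousOn μ' (Ici 0) ∧
        (∀ t ∈ Ici (0 : ℝ), HasDerivWithinAt μ (μ' t) (Ici 0) t) ∧
        μ 0 = 1 ∧
        (∀ t ∈ Ici (0 : ℝ), μ' t ≥ c * μ t * ∫ s in (0 : ℝ)..t, μ s) := by
  rintro ⟨μ, μ', -, hd, h0, hineq⟩
  have hμc : ContinuousOn μ (Ici 0) := fun t ht => (hd t ht).continuousWithinAt
  set ν : ℝ → ℝ := fun t => μ (max t 0) with hν
  have hνc : Continuous ν :=
    hμc.comp_continuous (by fun_prop) fun t => mem_Ici.2 (le_max_right t 0)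
  have hνμ : ∀ t, 0 ≤ t → ν t = μ t := fun t ht => by simp only [hν, max_eq_left ht]
  set M : ℝ → ℝ := fun t => ∫ s in (0 : ℝ)..t, ν s
  have hM : ∀ t, HasDerivAt M (ν t) t := fun t => hνc.integral_hasStrictDerivAt 0 t |>.hasDerivAt
  have hMc : Continuous M := continuous_iff_continuousAt.2 fun t => (hM t).continuousAt
  have hM0 : M 0 = 0 := intervalIntegral.integral_same
  have hMμ : ∀ t, 0 ≤ t → ∫ s in (0 : ℝ)..t, μ s = M t := by
    intro t ht
    refine intervalIntegral.integral_congr fun s hs => ?_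
    rw [uIcc_of_le ht] at hs
    exact (hνμ s hs.1).symm
  refine not_forall_one_add_mul_sq_le_deriv (half_pos hc) hM0 hM fun t ht => ?_
  have hmono : MonotoneOn (fun t => μ t - c / 2 * M t ^ 2) (Ici 0) := by
    refine monotoneOn_Ici_of_hasDerivAt_nonneg
      (hμc.sub (by fun_prop))
      (fun t ht => ((hd t ht.le).hasDerivAt (Ici_mem_nhds ht)).sub
        (((hM t).pow 2).const_mul (c / 2))) fun t ht => ?_
    have := hineq t ht.le
    rw [hMμ t ht.le] at this
    simp only [hνμ t ht.le]
    norm_num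
    linarith
  have hcmp := hmono (mem_Ici.2 le_rfl) (mem_Ici.2 ht) ht
  simp only [hM0, h0] at hcmp
  rw [hνμ t ht]
  linarith
end
end
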